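/- arXiv:2312.03083 — 2 statements merged into one kernel-verified Lean document; each statement's English description precedes it below -/
import Mathlib

section
/- Exactness of the penalty method for the dual SDP over all density matrices: let n ≥ 1, let H be a 2ⁿ×2ⁿ Hermitian complex matrix, and let D denote the set of all 2ⁿ×2ⁿ density matrices. Then f_D*(c) converges to λ_min(H) as c → ∞; that is, lim_{c→∞} sup_{η ∈ ℝ, ν ≥ 0, ω ∈ D} (η − c·‖H − ηI − νω‖₂²) = λ_min(H). -/
open Matrix
open scoped ComplexOrder

/-- The penalized dual-VQE objective `f_S*(c) = sup_{η ∈ ℝ, ν ≥ 0, ω ∈ S}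
(η − c‖H − ηI − νω‖₂²)`, where `‖Z‖₂² = Tr[Zᴴ Z]` is the squared
Hilbert–Schmidt norm. -/
noncomputable def dualVQEObjSup (n : ℕ) (H : Matrix (Fin (2 ^ n)) (Fin (2 ^ n)) ℂ)
    (S : Set (Matrix (Fin (2 ^ n)) (Fin (2 ^ n)) ℂ)) (c : ℝ) : ℝ :=
  sSup {v : ℝ | ∃ (η ν : ℝ) (ω : Matrix (Fin (2 ^ n)) (Fin (2 ^ n)) ℂ),
    ω ∈ S ∧ 0 ≤ ν ∧
    v = η - c * (((H - (η : ℂ) • 1 - (ν : ℂ) • ω)ᴴ *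
      (H - (η : ℂ) • 1 - (ν : ℂ) • ω)).trace).re}

section FrobeniusBounds

variable {ι : Type*} [Fintype ι]

theorem dotProduct_re_le_trace_conjTranspose_mul_self {Z : Matrix ι ι ℂ} (hZ : Z.IsHermitian)
    {x : ι → ℂ} (hx : star x ⬝ᵥ x = 1) (b : ℝ) :
    2 * b * (star x ⬝ᵥ (Z *ᵥ x)).re - b ^ 2 ≤ (Zᴴ * Z).trace.re := by
  have hP : (vecMulVec x (star x)).IsHermitian := (posSemidef_vecMulVec_self_star x).1
  have hPP : vecMulVec x (star x) * vecMulVec x (star x) = vecMulVec x (star x) := by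
    rw [vecMulVec_mul_vecMulVec, hx, one_smul]
  have htr : (vecMulVec x (star x)).trace = 1 := by
    rw [trace_vecMulVec, dotProduct_comm, hx]
  have hZP : (Z * vecMulVec x (star x)).trace = star x ⬝ᵥ (Z *ᵥ x) := by
    rw [mul_vecMulVec, trace_vecMulVec, dotProduct_comm]
  have hnonneg := (posSemidef_conjTranspose_mul_self
    (Z - (b : ℂ) • vecMulVec x (star x))).trace_nonneg
  have hexp : ((Z - (b : ℂ) • vecMulVec x (star x))ᴴ *
      (Z - (b : ℂ) • vecMulVec x (star x))).trace =
      (Zᴴ * Z).trace - ((2 * b : ℝ) : ℂ) * (star x ⬝ᵥ (Z *ᵥ x)) + ((b ^ 2 : ℝ) : ℂ) := by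
    have hPZ : (vecMulVec x (star x) * Z).trace = star x ⬝ᵥ (Z *ᵥ x) := by
      rw [trace_mul_comm, hZP]
    rw [conjTranspose_sub, conjTranspose_smul, hZ.eq, hP.eq]
    simp only [sub_mul, mul_sub, trace_sub, smul_mul_assoc, mul_smul_comm, trace_smul, hZP, hPZ,
      hPP, htr, smul_eq_mul, Complex.star_def, Complex.conj_ofReal]
    push_cast
    ring
  rw [hexp] at hnonneg
  have hre := (Complex.le_def.1 hnonneg).1
  rw [Complex.add_re, Complex.sub_re, Complex.re_ofReal_mul, Complex.ofReal_re,
    Complex.zero_re] at hre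
  linarith

variable [DecidableEq ι]

theorem Matrix.IsHermitian.posSemidef_sub_smul_one {H : Matrix ι ι ℂ} (hH : H.IsHermitian)
    {a : ℝ} (ha : ∀ i, a ≤ hH.eigenvalues i) : (H - (a : ℂ) • 1).PosSemidef := by
  have hdiag : (diagonal fun i => ((hH.eigenvalues i - a : ℝ) : ℂ)).PosSemidef :=
    .diagonal fun i => Complex.zero_le_real.2 (sub_nonneg.2 (ha i))
  have hconj := hdiag.mul_mul_conjTranspose_same (hH.eigenvectorUnitary : Matrix ι ι ℂ)
  have hd : (diagonal fun i => ((hH.eigenvalues i - a : ℝ) : ℂ)) =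
      diagonal (RCLike.ofReal ∘ hH.eigenvalues) - (a : ℂ) • 1 := by
    ext i j
    by_cases hij : i = j <;> simp [hij]
  have hU : (hH.eigenvectorUnitary : Matrix ι ι ℂ) *
      (hH.eigenvectorUnitary : Matrix ι ι ℂ)ᴴ = 1 :=
    Unitary.coe_mul_star_self hH.eigenvectorUnitary
  have hs := hH.spectral_theorem
  rw [Unitary.conjStarAlgAut_apply, star_eq_conjTranspose] at hs
  rw [hd, mul_sub, sub_mul, ← hs, mul_smul_comm, mul_one, smul_mul_assoc, hU] at hconj
  exact hconj

theorem penalized_objective_le {H : Matrix ι ι ℂ} (hH : H.IsHermitian) (i : ι) {c : ℝ}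
    (hc : 0 < c) (η : ℝ) {ν : ℝ} (hν : 0 ≤ ν) {ω : Matrix ι ι ℂ} (hω : ω.PosSemidef) :
    η - c * (((H - (η : ℂ) • 1 - (ν : ℂ) • ω)ᴴ *
      (H - (η : ℂ) • 1 - (ν : ℂ) • ω)).trace).re ≤ hH.eigenvalues i + 1 / (4 * c) := by
  set x : ι → ℂ := ⇑(hH.eigenvectorBasis i) with hxdef
  have hx : star x ⬝ᵥ x = 1 := by
    rw [dotProduct_comm, ← EuclideanSpace.inner_eq_star_dotProduct]
    simp
  have hZ : (H - (η : ℂ) • 1 - (ν : ℂ) • ω).IsHermitian := by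
    simp [IsHermitian, conjTranspose_sub, conjTranspose_smul, hH.eq, hω.1.eq]
  have hquad : (star x ⬝ᵥ ((H - (η : ℂ) • 1 - (ν : ℂ) • ω) *ᵥ x)).re =
      hH.eigenvalues i - η - ν * (star x ⬝ᵥ (ω *ᵥ x)).re := by
    simp only [sub_mulVec, smul_mulVec, one_mulVec, dotProduct_sub, dotProduct_smul, hx,
      smul_eq_mul, Complex.sub_re, Complex.re_ofReal_mul, mul_one]
    rw [hxdef, hH.eigenvalues_eq i]
    rfl
  have hωx := (Complex.le_def.1 (hω.dotProduct_mulVec_nonneg x)).1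
  have hbound := dotProduct_re_le_trace_conjTranspose_mul_self hZ hx (-(1 / (2 * c)))
  rw [hquad] at hbound
  have hmul := mul_le_mul_of_nonneg_left hbound hc.le
  have heq : c * (2 * -(1 / (2 * c)) *
      (hH.eigenvalues i - η - ν * (star x ⬝ᵥ (ω *ᵥ x)).re) - (-(1 / (2 * c))) ^ 2) =
      -(hH.eigenvalues i - η - ν * (star x ⬝ᵥ (ω *ᵥ x)).re) - 1 / (4 * c) := by
    field_simp
    ring
  rw [heq] at hmul
  have := mul_nonneg hν hωx
  linarith

theorem Matrix.PosSemidef.exists_eq_smul_density [Nonempty ι] {A : Matrix ι ι ℂ}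
    (hA : A.PosSemidef) :
    ∃ (ν : ℝ) (ω : Matrix ι ι ℂ), (ω.PosSemidef ∧ ω.trace = 1) ∧ 0 ≤ ν ∧ A = (ν : ℂ) • ω := by
  obtain ⟨t, ht, htA⟩ : ∃ t : ℝ, 0 ≤ t ∧ A.trace = (t : ℂ) := by
    have h := Complex.le_def.1 hA.trace_nonneg
    exact ⟨A.trace.re, h.1, Complex.ext rfl h.2.symm⟩
  rcases ht.eq_or_lt with rfl | ht
  · have hA0 : A = 0 := hA.trace_eq_zero_iff.1 (by simpa using htA)
    have i : ι := Classical.arbitrary ι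
    refine ⟨0, vecMulVec (Pi.single i 1) (star (Pi.single i 1)),
      ⟨posSemidef_vecMulVec_self_star _, ?_⟩, le_rfl, by simp [hA0]⟩
    simp [trace_vecMulVec]
  · have ht0 : (t : ℂ) ≠ 0 := Complex.ofReal_ne_zero.2 ht.ne'
    refine ⟨t, ((t⁻¹ : ℝ) : ℂ) • A,
      ⟨hA.smul (Complex.zero_le_real.2 (inv_nonneg.2 ht.le)), ?_⟩, ht.le, ?_⟩
    · simp [htA, ht0]
    · simp [smul_smul, ht0]

end FrobeniusBounds

/-- Exactness of the penalty method for the dual SDP over the set `D` of all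
density matrices: `f_D*(c) → λ_min(H)` as `c → ∞`. -/
theorem dualVQE_stmt10 (n : ℕ) (hn : 1 ≤ n)
    (H : Matrix (Fin (2 ^ n)) (Fin (2 ^ n)) ℂ) (hH : H.IsHermitian) :
    Filter.Tendsto (fun c : ℝ => dualVQEObjSup n H {ω | ω.PosSemidef ∧ ω.trace = 1} c)
      Filter.atTop (nhds (⨅ i, hH.eigenvalues i)) := by
  obtain ⟨i, hi⟩ := exists_eq_ciInf_of_finite (f := hH.eigenvalues)
  have hmin : ∀ j, hH.eigenvalues i ≤ hH.eigenvalues j := fun j =>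
    hi.trans_le (ciInf_le (Set.finite_range _).bddBelow j)
  rw [← hi]
  obtain ⟨ν, ω, hω, hν, hHω⟩ := (hH.posSemidef_sub_smul_one hmin).exists_eq_smul_density
  have hlim : Filter.Tendsto (fun c : ℝ => hH.eigenvalues i + 1 / (4 * c)) Filter.atTop
      (nhds (hH.eigenvalues i)) := by
    simpa using tendsto_const_nhds.add ((Filter.tendsto_id.const_mul_atTop
      (show (0 : ℝ) < 4 by norm_num)).inv_tendsto_atTop)
  have hmem (c : ℝ) : hH.eigenvalues i ∈ {v : ℝ | ∃ (η ν : ℝ)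
      (ω : Matrix (Fin (2 ^ n)) (Fin (2 ^ n)) ℂ),
      ω ∈ {ω : Matrix (Fin (2 ^ n)) (Fin (2 ^ n)) ℂ | ω.PosSemidef ∧ ω.trace = 1} ∧ 0 ≤ ν ∧
      v = η - c * (((H - (η : ℂ) • 1 - (ν : ℂ) • ω)ᴴ *
        (H - (η : ℂ) • 1 - (ν : ℂ) • ω)).trace).re} :=
    ⟨hH.eigenvalues i, ν, ω, hω, hν, by rw [hHω]; simp⟩
  refine tendsto_of_tendsto_of_tendsto_of_le_of_le' tendsto_const_nhds hlim ?_ ?_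
  · filter_upwards [Filter.eventually_gt_atTop 0] with c hc
    refine le_csSup ⟨hH.eigenvalues i + 1 / (4 * c), ?_⟩ (hmem c)
    rintro _ ⟨η, ν, ω, hω, hν, rfl⟩
    exact penalized_objective_le hH i hc η hν hω.1
  · filter_upwards [Filter.eventually_gt_atTop 0] with c hc
    refine csSup_le ⟨_, hmem c⟩ ?_
    rintro _ ⟨η, ν, ω, hω, hν, rfl⟩
    exact penalized_objective_le hH i hc η hν hω.1
end

section
/- Dual-VQE lower bound (main theorem): let n ≥ 1, let H be a 2ⁿ×2ⁿ Hermitian complex matrix, and let S be any nonempty set of 2ⁿ×2ⁿ density matrices (e.g., a parameterized family of ansatz states). Then the limit of f_S*(c) as c → ∞ is at most λ_min(H); equivalently, for every ε > 0 there exists c₀ > 0 such that for all c ≥ c₀, f_S*(c) ≤ λ_min(H) + ε. -/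
open Matrix
open scoped ComplexOrder

/-- The square of the real part of a diagonal entry is at most the squared Hilbert–Schmidt norm. -/
lemma Matrix.re_diag_sq_le_trace_conjTranspose_mul_self {m : Type*} [Fintype m]
    (W : Matrix m m ℂ) (i : m) : (W i i).re ^ 2 ≤ (Wᴴ * W).trace.re := by
  have htrace : (Wᴴ * W).trace.re = ∑ j, ∑ k, Complex.normSq (W k j) := by
    simp [Matrix.trace, Matrix.mul_apply, Complex.normSq_apply]
  calc (W i i).re ^ 2 ≤ Complex.normSq (W i i) := by
        rw [Complex.normSq_apply]; nlinarith [mul_self_nonneg (W i i).im]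
    _ ≤ ∑ k, Complex.normSq (W k i) :=
        Finset.single_le_sum (f := fun k => Complex.normSq (W k i))
          (fun k _ => Complex.normSq_nonneg _) (Finset.mem_univ i)
    _ ≤ ∑ j, ∑ k, Complex.normSq (W k j) :=
        Finset.single_le_sum (f := fun j => ∑ k, Complex.normSq (W k j))
          (fun j _ => Finset.sum_nonneg fun k _ => Complex.normSq_nonneg _) (Finset.mem_univ i)
    _ = (Wᴴ * W).trace.re := htrace.symm

/-- The Hilbert–Schmidt norm is invariant under unitary conjugation. -/
lemma Matrix.trace_conjTranspose_mul_self_unitary_conj {m : Type*} [Fintype m] [DecidableEq m]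
    {U : Matrix m m ℂ} (hU : U * Uᴴ = 1) (Z : Matrix m m ℂ) :
    ((Uᴴ * Z * U)ᴴ * (Uᴴ * Z * U)).trace = (Zᴴ * Z).trace := by
  have hconj : (Uᴴ * Z * U)ᴴ * (Uᴴ * Z * U) = Uᴴ * (Zᴴ * Z * U) := by
    simp only [Matrix.conjTranspose_mul, Matrix.conjTranspose_conjTranspose]
    calc _ = Uᴴ * (Zᴴ * (U * Uᴴ) * Z * U) := by simp only [Matrix.mul_assoc]
      _ = _ := by rw [hU, Matrix.mul_one]
  rw [hconj, Matrix.trace_mul_comm, Matrix.mul_assoc, hU, Matrix.mul_one]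

/-- For every eigenvalue `λ` of `H` and every `ω ≥ 0`, `ν ≥ 0`, there is a real `x` with
`η ≤ λ - x` and `x ^ 2 ≤ ‖H - η I - ν ω‖₂²`. -/
lemma Matrix.IsHermitian.exists_slack {m : Type*} [Fintype m] [DecidableEq m]
    {H : Matrix m m ℂ} (hH : H.IsHermitian) (i : m) {ω : Matrix m m ℂ} (hω : ω.PosSemidef)
    (η : ℝ) {ν : ℝ} (hν : 0 ≤ ν) :
    ∃ x : ℝ, η ≤ hH.eigenvalues i - x ∧
      x ^ 2 ≤ (((H - (η : ℂ) • 1 - (ν : ℂ) • ω)ᴴ * (H - (η : ℂ) • 1 - (ν : ℂ) • ω)).trace).re := by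
  let U : Matrix m m ℂ := (hH.eigenvectorUnitary).1
  have hU : U * Uᴴ = 1 := Unitary.coe_mul_star_self hH.eigenvectorUnitary
  have hU' : Uᴴ * U = 1 := Unitary.coe_star_mul_self hH.eigenvectorUnitary
  have hdiag : Uᴴ * H * U = Matrix.diagonal (fun j => (hH.eigenvalues j : ℂ)) := by
    have h := hH.conjStarAlgAut_star_eigenvectorUnitary
    rw [Unitary.conjStarAlgAut_star_apply] at h
    exact h
  have hpos : 0 ≤ ((Uᴴ * ω * U) i i).re :=
    (Complex.le_def.mp ((hω.conjTranspose_mul_mul_same U).diag_nonneg (i := i))).1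
  refine ⟨((Uᴴ * (H - (η : ℂ) • 1 - (ν : ℂ) • ω) * U) i i).re, ?_, ?_⟩
  · have hexp : Uᴴ * (H - (η : ℂ) • 1 - (ν : ℂ) • ω) * U
        = Matrix.diagonal (fun j => (hH.eigenvalues j : ℂ)) - (η : ℂ) • 1
          - (ν : ℂ) • (Uᴴ * ω * U) := by
      simp [Matrix.mul_sub, Matrix.sub_mul, hdiag, hU']
    rw [hexp]
    simp only [Matrix.sub_apply, Matrix.smul_apply, Matrix.diagonal_apply_eq, Matrix.one_apply_eq,
      Complex.sub_re, smul_eq_mul, Complex.re_ofReal_mul, Complex.ofReal_re, Complex.one_re]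
    nlinarith [mul_nonneg hν hpos]
  · rw [← Matrix.trace_conjTranspose_mul_self_unitary_conj hU]
    exact Matrix.re_diag_sq_le_trace_conjTranspose_mul_self _ i

/-- Dual-VQE lower bound (main theorem): for any nonempty set `S` of density matrices
(e.g., a parameterized ansatz family), the limiting value of `f_S*(c)` as `c → ∞` is at
most `λ_min(H)`: for every `ε > 0` there is `c₀ > 0` such that `f_S*(c) ≤ λ_min(H) + ε`
for all `c ≥ c₀`. -/
theorem dualVQE_stmt11 (n : ℕ) (hn : 1 ≤ n)
    (H : Matrix (Fin (2 ^ n)) (Fin (2 ^ n)) ℂ) (hH : H.IsHermitian)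
    (S : Set (Matrix (Fin (2 ^ n)) (Fin (2 ^ n)) ℂ)) (hS : S.Nonempty)
    (hSdens : ∀ ω ∈ S, ω.PosSemidef ∧ ω.trace = 1) :
    ∀ ε : ℝ, 0 < ε → ∃ c₀ : ℝ, 0 < c₀ ∧ ∀ c : ℝ, c₀ ≤ c →
      dualVQEObjSup n H S c ≤ (⨅ i, hH.eigenvalues i) + ε := by
  intro ε hε
  refine ⟨1 / (4 * ε), by positivity, fun c hc => ?_⟩
  have hc' : 1 ≤ c * (4 * ε) := (div_le_iff₀ (by positivity)).mp hc
  have hcpos : 0 < c := lt_of_lt_of_le (by positivity) hc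
  obtain ⟨ω₀, hω₀⟩ := hS
  refine csSup_le ⟨_, 0, 0, ω₀, hω₀, le_rfl, rfl⟩ ?_
  rintro v ⟨η, ν, ω, hω, hν, rfl⟩
  obtain ⟨i, hi⟩ := exists_eq_ciInf_of_finite (f := hH.eigenvalues)
  rw [← hi]
  obtain ⟨x, hx, hx2⟩ := hH.exists_slack i (hSdens ω hω).1 η hν
  have hquad : 0 ≤ c * x ^ 2 + x + ε := by
    have h : 0 ≤ c * (c * x ^ 2 + x + ε) := by nlinarith [sq_nonneg (2 * c * x + 1)]
    exact nonneg_of_mul_nonneg_right h hcpos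
  linarith [mul_le_mul_of_nonneg_left hx2 hcpos.le]
end
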